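/- Multiplicative performance difference lemma for stationary policies: let P' and P'' be two transition kernels on the same finite state space 𝒮 of size S and action space 𝒜 such that e^{−ε} P''_{s,a,s'} ≤ P'_{s,a,s'} ≤ e^{ε} P''_{s,a,s'} for all (s,a,s') and some ε ≥ 0. Then for every stationary policy π, every horizon d ≥ 1, every non-negative reward function r and every fixed initial distribution μ₁: e^{−4Sε} · W^π_d(r, P', μ₁) ≤ W^π_d(r, P'', μ₁) ≤ e^{4Sε} · W^π_d(r, P', μ₁). -/

import Mathlib

open scoped Classical BigOperators

/-- `valS p r π d s` is the expected total reward `E[Σ_{h=1}^d r(s_h,a_h)]` collected in `d`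
steps following the stationary policy `π` under the transition kernel `p`, starting from `s`. -/
noncomputable def valS {S A : Type*} [Fintype S] (p : S → A → S → ℝ)
    (r : S → A → ℝ) (π : S → A) : ℕ → S → ℝ
  | 0, _ => 0
  | d + 1, s => r s (π s) + ∑ s' : S, p s (π s) s' * valS p r π d s'

/-- `W_d^π(r, p, μ)`: expected total reward in `d` steps, from initial distribution `μ`. -/
noncomputable def W {S A : Type*} [Fintype S] (p : S → A → S → ℝ)
    (r : S → A → ℝ) (π : S → A) (d : ℕ) (μ : S → ℝ) : ℝ :=
  ∑ s : S, μ s * valS p r π d s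

/-- Expected reward collected within `n` steps by the Markov chain `p` before it visits `x`. -/
noncomputable def killedVal {S : Type*} [Fintype S] (p : S → S → ℝ) (ρ : S → ℝ) (x : S) :
    ℕ → S → ℝ
  | 0, _ => 0
  | n + 1, s => if s = x then 0 else ρ s + ∑ t, p s t * killedVal p ρ x n t

/-- Expected reward collected within `n` steps by the Markov chain `p` when a visit to `x` with
`m` steps remaining yields `w m`, and no other state yields a reward. -/
noncomputable def visitVal {S : Type*} [Fintype S] (p : S → S → ℝ) (x : S) (w : ℕ → ℝ) :
    ℕ → S → ℝ
  | 0, _ => 0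
  | n + 1, s => (if s = x then w (n + 1) else 0) + ∑ t, p s t * visitVal p x w n t

/-- Expected reward of one excursion from `x`, truncated at `n` steps. -/
noncomputable def excursionVal {S : Type*} [Fintype S] (p : S → S → ℝ) (ρ : S → ℝ) (x : S) :
    ℕ → ℝ
  | 0 => 0
  | n + 1 => ρ x + ∑ t, p x t * killedVal p ρ x n t

section MarkovChain

variable {S : Type*} [Fintype S] {p q : S → S → ℝ} {ρ : S → ℝ} {x : S} {w v : ℕ → ℝ}

theorem killedVal_nonneg (hp : ∀ s t, 0 ≤ p s t) (hρ : ∀ s, 0 ≤ ρ s) (n : ℕ) (s : S) :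
    0 ≤ killedVal p ρ x n s := by
  induction n generalizing s with
  | zero => simp [killedVal]
  | succ n ih =>
    rw [killedVal]
    split_ifs
    · exact le_rfl
    · exact add_nonneg (hρ s) (Finset.sum_nonneg fun t _ => mul_nonneg (hp s t) (ih t))

theorem killedVal_le_succ (hp : ∀ s t, 0 ≤ p s t) (hρ : ∀ s, 0 ≤ ρ s) (n : ℕ) (s : S) :
    killedVal p ρ x n s ≤ killedVal p ρ x (n + 1) s := by
  induction n generalizing s with
  | zero => exact killedVal_nonneg hp hρ 1 s
  | succ n ih =>
    rw [killedVal, killedVal]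
    split_ifs
    · exact le_rfl
    · gcongr with t _
      · exact hp s t
      · exact ih t

theorem killedVal_congr (hpq : ∀ s, s ≠ x → p s = q s) (n : ℕ) (s : S) :
    killedVal p ρ x n s = killedVal q ρ x n s := by
  induction n generalizing s with
  | zero => rfl
  | succ n ih =>
    rw [killedVal, killedVal]
    split_ifs with h
    · rfl
    · simp only [hpq s h, ih]

theorem excursionVal_nonneg (hp : ∀ s t, 0 ≤ p s t) (hρ : ∀ s, 0 ≤ ρ s) (n : ℕ) :
    0 ≤ excursionVal p ρ x n := by
  cases n with
  | zero => exact le_rfl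
  | succ n =>
    exact add_nonneg (hρ x) (Finset.sum_nonneg fun t _ =>
      mul_nonneg (hp x t) (killedVal_nonneg hp hρ n t))

theorem excursionVal_le_succ (hp : ∀ s t, 0 ≤ p s t) (hρ : ∀ s, 0 ≤ ρ s) (n : ℕ) :
    excursionVal p ρ x n ≤ excursionVal p ρ x (n + 1) := by
  cases n with
  | zero => exact excursionVal_nonneg hp hρ 1
  | succ n =>
    rw [excursionVal, excursionVal]
    gcongr with t _
    · exact hp x t
    · exact killedVal_le_succ hp hρ n t

theorem excursionVal_le_mul (hp : ∀ s t, 0 ≤ p s t) (hρ : ∀ s, 0 ≤ ρ s)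
    (hpq : ∀ s, s ≠ x → p s = q s) {c : ℝ} (hc : 1 ≤ c) (hle : ∀ t, p x t ≤ c * q x t)
    (n : ℕ) : excursionVal p ρ x n ≤ c * excursionVal q ρ x n := by
  cases n with
  | zero => simp [excursionVal]
  | succ n =>
    rw [excursionVal, excursionVal, mul_add, Finset.mul_sum]
    refine add_le_add (le_mul_of_one_le_left (hρ x) hc) (Finset.sum_le_sum fun t _ => ?_)
    rw [← killedVal_congr hpq, ← mul_assoc]
    exact mul_le_mul_of_nonneg_right (hle t) (killedVal_nonneg hp hρ n t)

theorem visitVal_nonneg (hp : ∀ s t, 0 ≤ p s t) (hw : ∀ n, 0 ≤ w n) (n : ℕ) (s : S) :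
    0 ≤ visitVal p x w n s := by
  induction n generalizing s with
  | zero => exact le_rfl
  | succ n ih =>
    refine add_nonneg ?_ (Finset.sum_nonneg fun t _ => mul_nonneg (hp s t) (ih t))
    split_ifs
    · exact hw _
    · exact le_rfl

theorem visitVal_le_succ (hp : ∀ s t, 0 ≤ p s t) (hw : ∀ n, 0 ≤ w n)
    (hmono : ∀ n, w n ≤ w (n + 1)) (n : ℕ) (s : S) :
    visitVal p x w n s ≤ visitVal p x w (n + 1) s := by
  induction n generalizing s with
  | zero => exact visitVal_nonneg hp hw 1 s
  | succ n ih =>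
    rw [visitVal, visitVal]
    refine add_le_add ?_ (Finset.sum_le_sum fun t _ =>
      mul_le_mul_of_nonneg_left (ih t) (hp s t))
    split_ifs
    · exact hmono _
    · exact le_rfl

theorem visitVal_le_visitVal_self (hp : ∀ s t, 0 ≤ p s t) (hp1 : ∀ s, ∑ t, p s t = 1)
    (hw : ∀ n, 0 ≤ w n) (hmono : ∀ n, w n ≤ w (n + 1)) (n : ℕ) (s : S) :
    visitVal p x w n s ≤ visitVal p x w n x := by
  induction n generalizing s with
  | zero => exact le_rfl
  | succ n ih =>
    by_cases h : s = x
    · rw [h]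
    · refine le_trans ?_ (visitVal_le_succ hp hw hmono n x)
      rw [visitVal, if_neg h, zero_add]
      calc ∑ t, p s t * visitVal p x w n t
          ≤ ∑ t, p s t * visitVal p x w n x :=
            Finset.sum_le_sum fun t _ => mul_le_mul_of_nonneg_left (ih t) (hp s t)
        _ = visitVal p x w n x := by rw [← Finset.sum_mul, hp1, one_mul]

theorem visitVal_le_mul_of_le_mul (hp : ∀ s t, 0 ≤ p s t) {c : ℝ}
    (hwv : ∀ n, w n ≤ c * v n) (n : ℕ) (s : S) :
    visitVal p x w n s ≤ c * visitVal p x v n s := by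
  induction n generalizing s with
  | zero => simp [visitVal]
  | succ n ih =>
    rw [visitVal, visitVal, mul_add, Finset.mul_sum]
    refine add_le_add ?_ (Finset.sum_le_sum fun t _ => ?_)
    · split_ifs
      · exact hwv _
      · simp
    · rw [mul_left_comm]
      exact mul_le_mul_of_nonneg_left (ih t) (hp s t)

/-- Perturbing the transitions out of `x` by a factor at most `c` changes the expected reward
for visits to `x` by a factor at most `c`, however long the horizon is. -/
theorem visitVal_le_mul_of_perturb (hp : ∀ s t, 0 ≤ p s t) (hp1 : ∀ s, ∑ t, p s t = 1)
    (hq : ∀ s t, 0 ≤ q s t) (hq1 : ∀ s, ∑ t, q s t = 1)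
    (hpq : ∀ s, s ≠ x → p s = q s) {c : ℝ} (hle : ∀ t, q x t ≤ c * p x t)
    (hw : ∀ n, 0 ≤ w n) (hmono : ∀ n, w n ≤ w (n + 1)) (n : ℕ) (s : S) :
    visitVal p x w n s ≤ c * visitVal q x w n s := by
  induction n generalizing s with
  | zero => simp [visitVal]
  | succ n ih =>
    have step : ∑ t, q s t * visitVal p x w n t ≤
        c * ∑ t, q s t * visitVal q x w n t := by
      rw [Finset.mul_sum]
      refine Finset.sum_le_sum fun t _ => ?_
      rw [mul_left_comm]
      exact mul_le_mul_of_nonneg_left (ih t) (hq s t)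
    by_cases h : s = x
    · subst h
      have hsucc : visitVal p s w (n + 1) s = w (n + 1) + ∑ t, p s t * visitVal p s w n t := by
        rw [visitVal, if_pos rfl]
      have hgap : ∀ t, 0 ≤ visitVal p s w (n + 1) s - visitVal p s w n t := fun t =>
        sub_nonneg.2 ((visitVal_le_visitVal_self hp hp1 hw hmono n t).trans
          (visitVal_le_succ hp hw hmono n s))
      have hsum : ∑ t, q s t * (visitVal p s w (n + 1) s - visitVal p s w n t) ≤
          c * ∑ t, p s t * (visitVal p s w (n + 1) s - visitVal p s w n t) := by
        rw [Finset.mul_sum]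
        refine Finset.sum_le_sum fun t _ => ?_
        rw [← mul_assoc]
        exact mul_le_mul_of_nonneg_right (hle t) (hgap t)
      simp only [mul_sub, Finset.sum_sub_distrib, ← Finset.sum_mul, hp1, hq1, one_mul] at hsum
      rw [visitVal.eq_2 q, if_pos rfl]
      linarith [congrArg (c * ·) hsucc]
    · rw [visitVal, visitVal, if_neg h, zero_add, zero_add, hpq s h]
      exact step

end MarkovChain

section Policy

variable {S A : Type*} [Fintype S] {P Q : S → A → S → ℝ} {r : S → A → ℝ} {π : S → A}

theorem valS_nonneg (hP : ∀ s a t, 0 ≤ P s a t) (hr : ∀ s a, 0 ≤ r s a) (n : ℕ) (s : S) :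
    0 ≤ valS P r π n s := by
  induction n generalizing s with
  | zero => exact le_rfl
  | succ n ih =>
    exact add_nonneg (hr _ _) (Finset.sum_nonneg fun t _ => mul_nonneg (hP _ _ _) (ih t))

theorem valS_eq_killedVal_add_visitVal (x : S) (n : ℕ) (s : S) :
    valS P r π n s = killedVal (fun s => P s (π s)) (fun s => r s (π s)) x n s +
      visitVal (fun s => P s (π s)) x
        (excursionVal (fun s => P s (π s)) (fun s => r s (π s)) x) n s := by
  induction n generalizing s with
  | zero => simp [valS, killedVal, visitVal]
  | succ n ih =>
    rw [valS, killedVal, visitVal, excursionVal]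
    simp only [ih, mul_add, Finset.sum_add_distrib]
    split_ifs with h
    · subst h
      ring
    · ring

/-- Perturbing the transitions out of a single state by a factor at most `c` changes the value
by a factor at most `c ^ 2`. -/
theorem valS_le_sq_mul_of_perturb (hP : ∀ s a t, 0 ≤ P s a t)
    (hP1 : ∀ s a, ∑ t, P s a t = 1) (hQ : ∀ s a t, 0 ≤ Q s a t)
    (hQ1 : ∀ s a, ∑ t, Q s a t = 1) (hr : ∀ s a, 0 ≤ r s a) {x : S}
    (hPQ : ∀ s, s ≠ x → P s = Q s) {c : ℝ} (hc : 1 ≤ c)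
    (hle : ∀ a t, P x a t ≤ c * Q x a t) (hge : ∀ a t, Q x a t ≤ c * P x a t)
    (n : ℕ) (s : S) : valS P r π n s ≤ c ^ 2 * valS Q r π n s := by
  set p : S → S → ℝ := fun s => P s (π s) with hp_def
  set q : S → S → ℝ := fun s => Q s (π s) with hq_def
  set ρ : S → ℝ := fun s => r s (π s) with hρ_def
  have hp : ∀ s t, 0 ≤ p s t := fun s t => hP s (π s) t
  have hq : ∀ s t, 0 ≤ q s t := fun s t => hQ s (π s) t
  have hρ : ∀ s, 0 ≤ ρ s := fun s => hr s (π s)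
  have hpq : ∀ s, s ≠ x → p s = q s := fun s h => congrFun (hPQ s h) (π s)
  have hvisit : visitVal p x (excursionVal p ρ x) n s ≤
      c ^ 2 * visitVal q x (excursionVal q ρ x) n s := by
    calc visitVal p x (excursionVal p ρ x) n s
        ≤ c * visitVal q x (excursionVal p ρ x) n s :=
          visitVal_le_mul_of_perturb hp (fun s => hP1 s (π s)) hq (fun s => hQ1 s (π s)) hpq
            (hge (π x)) (excursionVal_nonneg hp hρ) (excursionVal_le_succ hp hρ) n s
      _ ≤ c * (c * visitVal q x (excursionVal q ρ x) n s) :=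
          mul_le_mul_of_nonneg_left (visitVal_le_mul_of_le_mul hq
            (excursionVal_le_mul hp hρ hpq hc (hle (π x))) n s) (by linarith)
      _ = c ^ 2 * visitVal q x (excursionVal q ρ x) n s := by ring
  rw [valS_eq_killedVal_add_visitVal x, valS_eq_killedVal_add_visitVal (P := Q) x, mul_add,
    ← hp_def, ← hq_def, ← hρ_def, killedVal_congr hpq]
  exact add_le_add (le_mul_of_one_le_left (killedVal_nonneg hq hρ n s) (one_le_pow₀ hc)) hvisit

theorem valS_le_pow_card_mul (hP : ∀ s a t, 0 ≤ P s a t)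
    (hP1 : ∀ s a, ∑ t, P s a t = 1) (hQ : ∀ s a t, 0 ≤ Q s a t)
    (hQ1 : ∀ s a, ∑ t, Q s a t = 1) (hr : ∀ s a, 0 ≤ r s a) {c : ℝ} (hc : 1 ≤ c)
    (hle : ∀ s a t, P s a t ≤ c * Q s a t) (hge : ∀ s a t, Q s a t ≤ c * P s a t)
    (n : ℕ) (s : S) : valS P r π n s ≤ (c ^ 2) ^ Fintype.card S * valS Q r π n s := by
  have key : ∀ T : Finset S, valS P r π n s ≤
      (c ^ 2) ^ T.card * valS (fun s => if s ∈ T then Q s else P s) r π n s := by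
    intro T
    induction T using Finset.induction_on with
    | empty => simp
    | insert x T hx ih =>
      have hnn : ∀ (T : Finset S) (s : S) (a : A) (t : S),
          0 ≤ (fun s => if s ∈ T then Q s else P s) s a t := by
        intro T s a t
        dsimp only
        split_ifs
        · exact hQ s a t
        · exact hP s a t
      have hsum : ∀ (T : Finset S) (s : S) (a : A),
          ∑ t, (fun s => if s ∈ T then Q s else P s) s a t = 1 := by
        intro T s a
        dsimp only
        split_ifs
        · exact hQ1 s a
        · exact hP1 s a
      rw [Finset.card_insert_of_notMem hx, pow_succ, mul_assoc]
      refine ih.trans (mul_le_mul_of_nonneg_left ?_ (by positivity))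
      refine valS_le_sq_mul_of_perturb (x := x) (hnn T) (hsum T) (hnn _) (hsum _) hr ?_ hc ?_ ?_ n s
      · intro s hs
        simp [Finset.mem_insert, hs]
      · intro a t
        simpa [hx] using hle x a t
      · intro a t
        simpa [hx] using hge x a t
  simpa using key Finset.univ

theorem W_le_exp_mul (hP : ∀ s a t, 0 ≤ P s a t)
    (hP1 : ∀ s a, ∑ t, P s a t = 1) (hQ : ∀ s a t, 0 ≤ Q s a t)
    (hQ1 : ∀ s a, ∑ t, Q s a t = 1) (hr : ∀ s a, 0 ≤ r s a) {ε : ℝ} (hε : 0 ≤ ε)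
    (hle : ∀ s a t, P s a t ≤ Real.exp ε * Q s a t)
    (hge : ∀ s a t, Q s a t ≤ Real.exp ε * P s a t)
    {μ : S → ℝ} (hμ : ∀ s, 0 ≤ μ s) (n : ℕ) :
    W P r π n μ ≤ Real.exp (2 * (Fintype.card S : ℝ) * ε) * W Q r π n μ := by
  have hexp : (Real.exp ε ^ 2) ^ Fintype.card S = Real.exp (2 * (Fintype.card S : ℝ) * ε) := by
    rw [← pow_mul, ← Real.exp_nat_mul]
    push_cast
    rfl
  rw [W, W, Finset.mul_sum]
  refine Finset.sum_le_sum fun s _ => ?_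
  rw [mul_left_comm, ← hexp]
  exact mul_le_mul_of_nonneg_left
    (valS_le_pow_card_mul hP hP1 hQ hQ1 hr (Real.one_le_exp hε) hle hge n s) (hμ s)

theorem W_nonneg (hP : ∀ s a t, 0 ≤ P s a t) (hr : ∀ s a, 0 ≤ r s a)
    {μ : S → ℝ} (hμ : ∀ s, 0 ≤ μ s) (n : ℕ) : 0 ≤ W P r π n μ :=
  Finset.sum_nonneg fun s _ => mul_nonneg (hμ s) (valS_nonneg hP hr n s)

end Policy

/-- Multiplicative performance difference lemma for stationary policies:
if `e^{-ε} P''_{s,a,s'} ≤ P'_{s,a,s'} ≤ e^{ε} P''_{s,a,s'}` for all `(s,a,s')`, then for every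
stationary policy, horizon `d ≥ 1`, non-negative reward `r` and initial distribution `μ₁`,
`e^{-4Sε} W_d^π(r,P',μ₁) ≤ W_d^π(r,P'',μ₁) ≤ e^{4Sε} W_d^π(r,P',μ₁)`. -/
theorem multiplicative_performance_difference {S A : Type*} [Fintype S] [Fintype A]
    (P' P'' : S → A → S → ℝ)
    (hP'0 : ∀ s a s', 0 ≤ P' s a s') (hP'1 : ∀ s a, ∑ s' : S, P' s a s' = 1)
    (hP''0 : ∀ s a s', 0 ≤ P'' s a s') (hP''1 : ∀ s a, ∑ s' : S, P'' s a s' = 1)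
    (ε : ℝ) (hε : 0 ≤ ε)
    (hclose : ∀ s a s', Real.exp (-ε) * P'' s a s' ≤ P' s a s' ∧
      P' s a s' ≤ Real.exp ε * P'' s a s')
    (μ₁ : S → ℝ) (hμ0 : ∀ s, 0 ≤ μ₁ s) (hμ1 : ∑ s : S, μ₁ s = 1)
    (π : S → A) (d : ℕ) (hd : 1 ≤ d) (r : S → A → ℝ) (hr : ∀ s a, 0 ≤ r s a) :
    Real.exp (-(4 * (Fintype.card S : ℝ) * ε)) * W P' r π d μ₁ ≤ W P'' r π d μ₁ ∧
      W P'' r π d μ₁ ≤ Real.exp (4 * (Fintype.card S : ℝ) * ε) * W P' r π d μ₁ := by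
  have hle : ∀ s a s', P' s a s' ≤ Real.exp ε * P'' s a s' := fun s a s' => (hclose s a s').2
  have hge : ∀ s a s', P'' s a s' ≤ Real.exp ε * P' s a s' := by
    intro s a s'
    have h := (hclose s a s').1
    rwa [Real.exp_neg, inv_mul_le_iff₀ (Real.exp_pos ε)] at h
  have hmono : Real.exp (2 * (Fintype.card S : ℝ) * ε) ≤
      Real.exp (4 * (Fintype.card S : ℝ) * ε) := by
    gcongr
    norm_num
  constructor
  · rw [Real.exp_neg, inv_mul_le_iff₀ (Real.exp_pos _)]
    exact (W_le_exp_mul hP'0 hP'1 hP''0 hP''1 hr hε hle hge hμ0 d).trans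
      (mul_le_mul_of_nonneg_right hmono (W_nonneg hP''0 hr hμ0 d))
  · exact (W_le_exp_mul hP''0 hP''1 hP'0 hP'1 hr hε hge hle hμ0 d).trans
      (mul_le_mul_of_nonneg_right hmono (W_nonneg hP'0 hr hμ0 d))
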